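/- The label set Σ_ℛℛ of ℛ̄(ℛ(Π)) equals {⟨⟨ℓ(C)⟩⟩ : C ⊆ 𝔠}, where ⟨⟨ℓ(C)⟩⟩ = {⟨ℓ(C')⟩ : C ⊆ C' ⊆ 𝔠}, and the hyperedge constraint ℰ_ℛℛ of ℛ̄(ℛ(Π)) consists exactly of the configurations ⟨⟨ℓ(C_1)⟩⟩ … ⟨⟨ℓ(C_r)⟩⟩ of such labels for which, for each color i ∈ 𝔠, there is at least one index 1 ≤ j ≤ r with i ∉ C_j. -/

import Mathlib

open scoped Classical

/-- `StrEq 𝒞 B A` : the label `A` is at least as strong as the label `B` according to the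
constraint `𝒞` (written `B ≤ A`): every configuration of `𝒞` containing `B` remains a
configuration of `𝒞` after replacing one occurrence of `B` by `A`. -/
def StrEq {L : Type*} [DecidableEq L] (𝒞 : Set (Multiset L)) (B A : L) : Prop :=
  ∀ m ∈ 𝒞, B ∈ m → (A ::ₘ m.erase B) ∈ 𝒞

/-- `IsChoice m c` : the multiset `c` is obtained by choosing one element from each of the
sets in the configuration `m`. -/
def IsChoice {L : Type*} (m : Multiset (Set L)) (c : Multiset L) : Prop :=
  Multiset.Rel (fun B a => a ∈ B) m c

/-- The hyperedge constraint ℰ_Π: the label `ℓ(C)` is identified with the color set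
`C ⊆ 𝔠 = {1, …, Δ}` (here `Finset (Fin Δ)`), and a hyperedge configuration is a multiset of
`r` labels `ℓ(C₁) … ℓ(C_r)` such that for each color `i` there is at least one index `j`
with `i ∉ C_j`. -/
def EPi (Δ r : ℕ) : Set (Multiset (Finset (Fin Δ))) :=
  {m | Multiset.card m = r ∧ ∀ i : Fin Δ, ∃ C ∈ m, i ∉ C}

/-- The node constraint 𝒩_Π: the configurations `ℓ(C)^{Δ−|C|+1} ℓ(∅)^{|C|−1}` for
nonempty `C ⊆ 𝔠`. -/
def NPi (Δ : ℕ) : Set (Multiset (Finset (Fin Δ))) :=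
  {m | ∃ C : Finset (Fin Δ), C ≠ ∅ ∧
    m = Multiset.replicate (Δ - C.card + 1) C +
        Multiset.replicate (C.card - 1) (∅ : Finset (Fin Δ))}

/-- `⟨ℓ(C)⟩`, the set of all labels at least as strong as `ℓ(C)` according to ℰ_Π. -/
def genE (Δ r : ℕ) (C : Finset (Fin Δ)) : Set (Finset (Fin Δ)) :=
  {A | StrEq (EPi Δ r) C A}

/-- Configurations `B₁ … B_r` of nonempty subsets of Σ_Π all of whose choices form
configurations of ℰ_Π. -/
def ECand (Δ r : ℕ) : Set (Multiset (Set (Finset (Fin Δ)))) :=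
  {m | Multiset.card m = r ∧ (∀ B ∈ m, B.Nonempty) ∧ ∀ c, IsChoice m c → c ∈ EPi Δ r}

/-- The hyperedge constraint ℰ_ℛ of ℛ(Π): the maximal configurations among `ECand`. -/
def ER (Δ r : ℕ) : Set (Multiset (Set (Finset (Fin Δ)))) :=
  {m | m ∈ ECand Δ r ∧ ∀ m' ∈ ECand Δ r, Multiset.Rel (· ⊆ ·) m m' → m = m'}

/-- The label set Σ_ℛ of ℛ(Π): the subsets of Σ_Π occurring in configurations of ℰ_ℛ. -/
def SigR (Δ r : ℕ) : Set (Set (Finset (Fin Δ))) :=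
  {B | ∃ m ∈ ER Δ r, B ∈ m}

/-- The node constraint 𝒩_ℛ of ℛ(Π): configurations `B₁ … B_Δ` of labels of Σ_ℛ such that
some choice forms a configuration of 𝒩_Π. -/
def NR (Δ r : ℕ) : Set (Multiset (Set (Finset (Fin Δ)))) :=
  {m | Multiset.card m = Δ ∧ (∀ B ∈ m, B ∈ SigR Δ r) ∧ ∃ c, IsChoice m c ∧ c ∈ NPi Δ}

/-- `⟨⟨ℓ(C)⟩⟩ = {⟨ℓ(C')⟩ : C ⊆ C' ⊆ 𝔠}`. -/
def gen2 (Δ r : ℕ) (C : Finset (Fin Δ)) : Set (Set (Finset (Fin Δ))) :=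
  {B | ∃ C' : Finset (Fin Δ), C ⊆ C' ∧ B = genE Δ r C'}

/-- Configurations `Q₁ … Q_Δ` of nonempty subsets of Σ_ℛ all of whose choices form
configurations of 𝒩_ℛ. -/
def NCand (Δ r : ℕ) : Set (Multiset (Set (Set (Finset (Fin Δ))))) :=
  {m | Multiset.card m = Δ ∧ (∀ Q ∈ m, Q.Nonempty ∧ Q ⊆ SigR Δ r) ∧
       ∀ c, IsChoice m c → c ∈ NR Δ r}

/-- The node constraint 𝒩_ℛℛ of ℛ̄(ℛ(Π)): the maximal configurations among `NCand`. -/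
def NRR (Δ r : ℕ) : Set (Multiset (Set (Set (Finset (Fin Δ))))) :=
  {m | m ∈ NCand Δ r ∧ ∀ m' ∈ NCand Δ r, Multiset.Rel (· ⊆ ·) m m' → m = m'}

/-- The label set Σ_ℛℛ of ℛ̄(ℛ(Π)): the subsets of Σ_ℛ occurring in 𝒩_ℛℛ. -/
def SigRR (Δ r : ℕ) : Set (Set (Set (Finset (Fin Δ)))) :=
  {Q | ∃ m ∈ NRR Δ r, Q ∈ m}

/-- The hyperedge constraint ℰ_ℛℛ of ℛ̄(ℛ(Π)): configurations `Q₁ … Q_r` of labels of Σ_ℛℛ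
such that some choice forms a configuration of ℰ_ℛ. -/
def ERR (Δ r : ℕ) : Set (Multiset (Set (Set (Finset (Fin Δ))))) :=
  {m | Multiset.card m = r ∧ (∀ Q ∈ m, Q ∈ SigRR Δ r) ∧ ∃ c, IsChoice m c ∧ c ∈ ER Δ r}

/-- multiset of values of a function -/
def MM {ι β : Type*} [Fintype ι] (f : ι → β) : Multiset β := (Finset.univ : Finset ι).val.map f

lemma mem_MM {ι β : Type*} [Fintype ι] (f : ι → β) (b : β) : b ∈ MM f ↔ ∃ i, f i = b := by
  simp [MM]

lemma card_MM {n : ℕ} {β : Type*} (f : Fin n → β) : Multiset.card (MM f) = n := by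
  simp [MM]

lemma exists_MM {n : ℕ} {β : Type*} (m : Multiset β) (h : Multiset.card m = n) :
    ∃ f : Fin n → β, m = MM f := by
  subst h
  induction m using Quotient.inductionOn with
  | h l =>
    refine ⟨fun i => l.get ⟨i.1, by simpa using i.2⟩, ?_⟩
    simp only [MM, Fin.univ_val_map]
    refine congrArg _ ?_
    exact (List.ofFn_get l).symm

lemma rel_aux {ι β : Type*} [Nonempty β] (p : ι → β → Prop) (s : Finset ι) :
    ∀ t : Multiset β, Multiset.Rel p s.val t → ∃ g : ι → β, t = s.val.map g ∧ ∀ i ∈ s, p i (g i) := by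
  induction s using Finset.induction_on with
  | empty =>
    intro t ht
    have : t = 0 := by simpa using ht
    exact ⟨fun _ => Classical.arbitrary β, by simp [this], by simp⟩
  | insert a s ha ih =>
    intro t ht
    rw [Finset.insert_val_of_notMem ha, Multiset.rel_cons_left] at ht
    obtain ⟨b, t', hb, ht', rfl⟩ := ht
    obtain ⟨g, hg, hg'⟩ := ih t' ht'
    refine ⟨Function.update g a b, ?_, ?_⟩
    · rw [Finset.insert_val_of_notMem ha, Multiset.map_cons, hg]
      simp only [Function.update_self]
      congr 1
      apply Multiset.map_congr rfl
      intro x hx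
      have : x ≠ a := by rintro rfl; exact ha hx
      simp [this]
    · intro i hi
      by_cases h : i = a
      · subst h; simpa using hb
      · simpa [h] using hg' i (by simpa [h] using hi)

lemma rel_MM {ι α β : Type*} [Fintype ι] [Nonempty β] (r : α → β → Prop) (f : ι → α)
    (t : Multiset β) (h : Multiset.Rel r (MM f) t) :
    ∃ g : ι → β, t = MM g ∧ ∀ i, r (f i) (g i) := by
  rw [MM, Multiset.rel_map_left] at h
  obtain ⟨g, hg, hg'⟩ := rel_aux _ _ t h
  exact ⟨g, hg, fun i => hg' i (Finset.mem_univ i)⟩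

lemma rel_MM_mk {ι α β : Type*} [Fintype ι] (r : α → β → Prop) (f : ι → α)
    (g : ι → β) (h : ∀ i, r (f i) (g i)) : Multiset.Rel r (MM f) (MM g) := by
  rw [MM, MM, Multiset.rel_map]
  exact Multiset.rel_refl_of_refl_on fun x _ => h x

lemma mem_genE {Δ r : ℕ} (hr : 2 ≤ r) (C A : Finset (Fin Δ)) : A ∈ genE Δ r C ↔ A ⊆ C := by
  constructor
  · intro h
    by_contra hn
    obtain ⟨i, hiA, hiC⟩ := Finset.not_subset.1 hn
    have := h (C ::ₘ Multiset.replicate (r-1) {i}) (by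
      refine ⟨by simp; omega, fun k => ?_⟩
      by_cases hk : k = i
      · subst hk; exact ⟨C, by simp, hiC⟩
      · exact ⟨{i}, by simp [Multiset.mem_replicate]; right; omega, by simpa using hk⟩) (by simp)
    obtain ⟨D, hD, hiD⟩ := this.2 i
    simp [Multiset.mem_replicate] at hD
    rcases hD with rfl | ⟨_, rfl⟩
    · exact hiD hiA
    · simp at hiD
  · intro h m hm hC
    obtain ⟨m', rfl⟩ := Multiset.exists_cons_of_mem hC
    refine ⟨by simpa using hm.1, fun i => ?_⟩
    obtain ⟨D, hD, hi⟩ := hm.2 i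
    rcases Multiset.mem_cons.1 hD with rfl | hD
    · exact ⟨A, by simp, fun h' => hi (h h')⟩
    · exact ⟨D, by simp [hD], hi⟩

lemma genE_inj {Δ r : ℕ} (hr : 2 ≤ r) {C D : Finset (Fin Δ)} (h : genE Δ r C = genE Δ r D) :
    C = D := by
  apply Finset.Subset.antisymm
  · rw [← mem_genE hr, ← h, mem_genE hr]
  · rw [← mem_genE hr, h, mem_genE hr]

lemma ECand_MM {Δ r : ℕ} (f : Fin r → Set (Finset (Fin Δ))) :
    MM f ∈ ECand Δ r ↔ (∀ j, (f j).Nonempty) ∧ ∀ i, ∃ j, ∀ A ∈ f j, i ∉ A := by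
  constructor
  · rintro ⟨_, h2, h3⟩
    have h2' : ∀ j, (f j).Nonempty := fun j => h2 _ ((mem_MM _ _).2 ⟨j, rfl⟩)
    refine ⟨h2', fun i => ?_⟩
    by_contra hn
    push Not at hn
    choose g hg hg' using hn
    obtain ⟨C, hC, hi⟩ := (h3 (MM g) (rel_MM_mk _ _ _ hg)).2 i
    obtain ⟨j, rfl⟩ := (mem_MM _ _).1 hC
    exact hi (hg' j)
  · rintro ⟨h1, h2⟩
    refine ⟨card_MM f, ?_, ?_⟩
    · intro B hB
      obtain ⟨j, rfl⟩ := (mem_MM _ _).1 hB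
      exact h1 j
    · intro c hc
      obtain ⟨g, rfl, hg⟩ := rel_MM _ _ _ hc
      refine ⟨card_MM g, fun i => ?_⟩
      obtain ⟨j, hj⟩ := h2 i
      exact ⟨g j, (mem_MM _ _).2 ⟨j, rfl⟩, hj _ (hg j)⟩

lemma ER_form {Δ r : ℕ} (hr : 2 ≤ r) (m) (hm : m ∈ ER Δ r) :
    ∃ C : Fin r → Finset (Fin Δ), m = MM (fun j => genE Δ r (C j)) := by
  obtain ⟨f, rfl⟩ := exists_MM m hm.1.1
  have h := (ECand_MM f).1 hm.1
  refine ⟨fun j => Finset.univ.filter (fun i => ∃ A ∈ f j, i ∈ A), ?_⟩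
  apply hm.2
  · rw [ECand_MM]
    refine ⟨fun j => ⟨∅, by simp [mem_genE hr]⟩, fun i => ?_⟩
    obtain ⟨j, hj⟩ := h.2 i
    refine ⟨j, fun A hA hi => ?_⟩
    rw [mem_genE hr] at hA
    have := hA hi
    simp at this
    obtain ⟨A, hA, hiA⟩ := this
    exact hj A hA hiA
  · apply rel_MM_mk
    intro j A hA
    rw [mem_genE hr]
    intro i hi
    simp
    exact ⟨A, hA, hi⟩

lemma ER_of {Δ r : ℕ} (hr : 2 ≤ r) (C : Fin r → Finset (Fin Δ)) (u : Fin Δ → Fin r)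
    (hu : ∀ i j, i ∉ C j ↔ j = u i) : MM (fun j => genE Δ r (C j)) ∈ ER Δ r := by
  constructor
  · rw [ECand_MM]
    refine ⟨fun j => ⟨∅, by simp [mem_genE hr]⟩, fun i => ⟨u i, fun A hA hi => ?_⟩⟩
    rw [mem_genE hr] at hA
    exact (hu i (u i)).2 rfl (hA hi)
  · intro m' hm' hrel
    obtain ⟨g, rfl, hg⟩ := rel_MM _ _ _ hrel
    rw [ECand_MM] at hm'
    congr 1
    funext j
    apply Set.Subset.antisymm (hg j)
    intro D hD
    rw [mem_genE hr]
    intro i hi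
    by_contra hn
    obtain ⟨k, hk⟩ := hm'.2 i
    have : k = u i := (hu i k).1 (hk _ (hg k ((mem_genE hr _ _).2 (Finset.Subset.refl _))))
    have h2 : j = u i := (hu i j).1 hn
    rw [this, ← h2] at hk
    exact hk D hD hi

lemma SigR_eq {Δ r : ℕ} (hr : 2 ≤ r) (B) : B ∈ SigR Δ r ↔ ∃ C, B = genE Δ r C := by
  constructor
  · rintro ⟨m, hm, hB⟩
    obtain ⟨C, rfl⟩ := ER_form hr m hm
    obtain ⟨j, rfl⟩ := (mem_MM _ _).1 hB
    exact ⟨_, rfl⟩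
  · rintro ⟨C, rfl⟩
    let a : Fin r := ⟨0, by omega⟩
    let b : Fin r := ⟨1, by omega⟩
    have hab : a ≠ b := by simp [a, b]
    let u : Fin Δ → Fin r := fun i => if i ∈ C then b else a
    let F : Fin r → Finset (Fin Δ) := fun j => Finset.univ.filter (fun i => j ≠ u i)
    refine ⟨_, ER_of hr F u (by intro i j; simp [F]), (mem_MM _ _).2 ⟨a, ?_⟩⟩
    congr 1
    ext i
    by_cases h : i ∈ C <;> simp [F, u, h, hab]

lemma MM_ite {Δ : ℕ} {β : Type*} (S : Finset (Fin Δ)) (a b : β) :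
    MM (fun j => if j ∈ S then a else b) =
      Multiset.replicate S.card a + Multiset.replicate (Δ - S.card) b := by
  have h : (Finset.univ : Finset (Fin Δ)).val = S.val + Sᶜ.val := by
    rw [← Finset.disjUnion_val S Sᶜ disjoint_compl_right, Finset.disjUnion_eq_union]
    simp
  rw [MM, h, Multiset.map_add]
  congr 1
  · have h2 : ∀ x ∈ S.val, (if x ∈ S then a else b) = a := fun x hx => if_pos hx
    rw [Multiset.map_congr rfl h2, Multiset.map_const']
    rfl
  · have h2 : ∀ x ∈ Sᶜ.val, (if x ∈ S then a else b) = b :=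
      fun x hx => if_neg (Finset.mem_compl.1 hx)
    rw [Multiset.map_congr rfl h2, Multiset.map_const']
    congr 1
    exact (Finset.card_compl S).trans (by simp)

lemma NR_MM {Δ r : ℕ} (hr : 2 ≤ r) (D : Fin Δ → Finset (Fin Δ)) :
    MM (fun j => genE Δ r (D j)) ∈ NR Δ r ↔
      ∃ C : Finset (Fin Δ), C ≠ ∅ ∧
        Δ + 1 ≤ (Finset.univ.filter (fun j => C ⊆ D j)).card + C.card := by
  constructor
  · rintro ⟨_, _, c, hc, C, hC, rfl⟩
    obtain ⟨g, hg, hg'⟩ := rel_MM _ _ _ hc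
    refine ⟨C, hC, ?_⟩
    have h1 := congrArg (Multiset.count C) hg
    rw [Multiset.count_add, Multiset.count_replicate_self, Multiset.count_replicate,
      if_neg (Ne.symm hC), MM, Multiset.count_map] at h1
    have h2 : Multiset.card (Multiset.filter (fun a => C = g a) (Finset.univ : Finset (Fin Δ)).val)
        ≤ (Finset.univ.filter (fun j => C ⊆ D j)).card := by
      change (Finset.univ.filter (fun a => C = g a)).card ≤ _
      apply Finset.card_le_card
      intro j hj
      simp at hj ⊢
      rw [hj]
      exact (mem_genE hr _ _).1 (hg' j)
    have h3 : C.card ≤ Δ := by simpa using Finset.card_le_univ C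
    omega
  · rintro ⟨C, hC, h⟩
    have h3 : C.card ≤ Δ := by simpa using Finset.card_le_univ C
    have h4 : 0 < C.card := Finset.card_pos.2 (Finset.nonempty_iff_ne_empty.2 hC)
    obtain ⟨S, hS, hcard⟩ := Finset.exists_subset_card_eq
      (s := Finset.univ.filter (fun j => C ⊆ D j)) (n := Δ - C.card + 1) (by omega)
    refine ⟨card_MM _, ?_, MM (fun j => if j ∈ S then C else ∅), ?_, C, hC, ?_⟩
    · intro B hB
      obtain ⟨j, rfl⟩ := (mem_MM _ _).1 hB
      exact (SigR_eq hr _).2 ⟨_, rfl⟩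
    · apply rel_MM_mk
      intro j
      rw [mem_genE hr]
      split_ifs with hj
      · simpa using hS hj
      · simp
    · rw [MM_ite, hcard]
      congr 2
      omega

lemma NCand_MM {Δ r : ℕ} (hr : 2 ≤ r) (Q : Fin Δ → Set (Set (Finset (Fin Δ)))) :
    MM Q ∈ NCand Δ r ↔ (∀ j, (Q j).Nonempty ∧ Q j ⊆ SigR Δ r) ∧
      ∀ D : Fin Δ → Finset (Fin Δ), (∀ j, genE Δ r (D j) ∈ Q j) →
      ∃ C : Finset (Fin Δ), C ≠ ∅ ∧
        Δ + 1 ≤ (Finset.univ.filter (fun j => C ⊆ D j)).card + C.card := by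
  constructor
  · rintro ⟨_, h2, h3⟩
    refine ⟨fun j => h2 _ ((mem_MM _ _).2 ⟨j, rfl⟩), fun D hD => ?_⟩
    exact (NR_MM hr D).1 (h3 _ (rel_MM_mk _ _ _ hD))
  · rintro ⟨h1, h2⟩
    refine ⟨card_MM _, ?_, ?_⟩
    · intro B hB
      obtain ⟨j, rfl⟩ := (mem_MM _ _).1 hB
      exact h1 j
    · intro c hc
      obtain ⟨g, rfl, hg⟩ := rel_MM _ _ _ hc
      have : ∀ j, ∃ D, g j = genE Δ r D := fun j => (SigR_eq hr _).1 ((h1 j).2 (hg j))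
      choose D hD using this
      obtain rfl : g = fun j => genE Δ r (D j) := funext hD
      exact (NR_MM hr D).2 (h2 D hg)

lemma gen2_empty {Δ r : ℕ} (hr : 2 ≤ r) : gen2 Δ r ∅ = SigR Δ r := by
  ext B
  rw [SigR_eq hr]
  simp [gen2]

lemma mem_gen2 {Δ r : ℕ} (hr : 2 ≤ r) (C D : Finset (Fin Δ)) :
    genE Δ r D ∈ gen2 Δ r C ↔ C ⊆ D := by
  constructor
  · rintro ⟨C', h, h'⟩
    rw [genE_inj hr h']; exact h
  · intro h; exact ⟨D, h, rfl⟩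

lemma NCand_std {Δ r : ℕ} (hr : 2 ≤ r) (C : Finset (Fin Δ)) (hC : C ≠ ∅) (S : Finset (Fin Δ))
    (hS : Δ + 1 ≤ S.card + C.card) :
    MM (fun j => gen2 Δ r (if j ∈ S then C else ∅)) ∈ NCand Δ r := by
  rw [NCand_MM hr]
  constructor
  · intro j
    refine ⟨⟨_, _, Finset.Subset.refl _, rfl⟩, ?_⟩
    rintro B ⟨D, _, rfl⟩
    exact (SigR_eq hr _).2 ⟨_, rfl⟩
  · intro D hD
    refine ⟨C, hC, hS.trans ?_⟩
    gcongr
    intro j hj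
    have := (mem_gen2 hr _ _).1 (hD j)
    rw [if_pos hj] at this
    simpa using this

lemma hall_step {Δ r : ℕ} (hr : 2 ≤ r) (Q : Fin Δ → Set (Set (Finset (Fin Δ))))
    (h : MM Q ∈ NCand Δ r) : ∃ C : Finset (Fin Δ), C ≠ ∅ ∧
      Δ + 1 ≤ (Finset.univ.filter (fun j => Q j ⊆ gen2 Δ r C)).card + C.card := by
  rw [NCand_MM hr] at h
  obtain ⟨h1, h2⟩ := h
  by_contra hn
  push Not at hn
  let t : Fin Δ → Finset (Fin Δ) := fun i =>
    Finset.univ.filter (fun j => ∃ D, genE Δ r D ∈ Q j ∧ i ∉ D)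
  have hall : ∀ s : Finset (Fin Δ), s.card ≤ (s.biUnion t).card := by
    intro s
    by_cases hs : s = ∅
    · subst hs; simp
    have h3 := hn s (Finset.nonempty_iff_ne_empty.2 hs)
    have h4 : (s.biUnion t)ᶜ ⊆ Finset.univ.filter (fun j => Q j ⊆ gen2 Δ r s) := by
      intro j hj
      simp only [Finset.mem_compl, Finset.mem_biUnion, t, Finset.mem_filter, Finset.mem_univ,
        true_and] at hj ⊢
      intro B hB
      obtain ⟨D, rfl⟩ := (SigR_eq hr _).1 ((h1 j).2 hB)
      rw [mem_gen2 hr]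
      intro i hi
      by_contra hiD
      exact hj ⟨i, hi, D, hB, hiD⟩
    have h5 := Finset.card_le_card h4
    have h6 := Finset.card_add_card_compl (s.biUnion t)
    rw [Fintype.card_fin] at h6
    omega
  obtain ⟨σ, hσ, hσt⟩ := (Finset.all_card_le_biUnion_card_iff_exists_injective t).1 hall
  have hbij : Function.Bijective σ := Finite.injective_iff_bijective.1 hσ
  have : ∀ j, ∃ D, genE Δ r D ∈ Q j ∧ ∀ i, σ i = j → i ∉ D := by
    intro j
    obtain ⟨i, rfl⟩ := hbij.2 j
    have := hσt i
    simp only [t, Finset.mem_filter, Finset.mem_univ, true_and] at this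
    obtain ⟨D, hD, hi⟩ := this
    exact ⟨D, hD, fun k hk => by rw [hσ hk]; exact hi⟩
  choose D hD hD' using this
  obtain ⟨C, hC, hcard⟩ := h2 D hD
  have h7 : C.image σ ⊆ (Finset.univ.filter (fun j => C ⊆ D j))ᶜ := by
    intro j hj
    obtain ⟨i, hi, rfl⟩ := Finset.mem_image.1 hj
    simp only [Finset.mem_compl, Finset.mem_filter, Finset.mem_univ, true_and]
    intro hsub
    exact hD' _ i rfl (hsub hi)
  have h8 := Finset.card_le_card h7
  rw [Finset.card_image_of_injective _ hσ] at h8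
  have h9 := Finset.card_add_card_compl (Finset.univ.filter (fun j => C ⊆ D j))
  rw [Fintype.card_fin] at h9
  omega

lemma NRR_std {Δ r : ℕ} (hr : 2 ≤ r) (C : Finset (Fin Δ)) (hC : C ≠ ∅) (S : Finset (Fin Δ))
    (hS : S.card + C.card = Δ + 1) :
    MM (fun j => gen2 Δ r (if j ∈ S then C else ∅)) ∈ NRR Δ r := by
  refine ⟨NCand_std hr C hC S hS.ge, ?_⟩
  intro m' hm' hrel
  obtain ⟨Q, rfl, hQ⟩ := rel_MM _ _ _ hrel
  rw [NCand_MM hr] at hm'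
  congr 1
  funext j
  apply Set.Subset.antisymm (hQ j)
  by_cases hj : j ∈ S
  swap
  · simp only [hj, if_false]
    rw [gen2_empty hr]
    exact (hm'.1 j).2
  simp only [hj, if_true]
  intro B hB
  obtain ⟨E, rfl⟩ := (SigR_eq hr _).1 ((hm'.1 j).2 hB)
  rw [mem_gen2 hr]
  obtain ⟨C', hC', hcard⟩ := hm'.2 (fun k => if k = j then E else if k ∈ S then C else ∅) (by
    intro k
    by_cases hk : k = j
    · subst hk; simpa using hB
    · simp only [hk, if_false]
      exact hQ k ((mem_gen2 hr _ _).2 (Finset.Subset.refl _)))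
  have hsub : Finset.univ.filter
      (fun k => C' ⊆ (if k = j then E else if k ∈ S then C else ∅)) ⊆ S := by
    intro k hk
    simp only [Finset.mem_filter, Finset.mem_univ, true_and] at hk
    split_ifs at hk with h1 h2
    · exact h1 ▸ hj
    · exact h2
    · exact absurd (Finset.subset_empty.1 hk) hC'
  have hle := Finset.card_le_card hsub
  have hge : C.card ≤ C'.card := by omega
  have hC'le : C'.card ≤ Δ := by simpa using Finset.card_le_univ C'
  by_cases hCC : C' ⊆ C
  · have : C' = C := Finset.eq_of_subset_of_card_le hCC hge
    subst this
    have heq := Finset.eq_of_subset_of_card_le hsub (by omega)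
    have : j ∈ S := hj
    rw [← heq] at this
    simpa using this
  · have hsub2 : Finset.univ.filter
        (fun k => C' ⊆ (if k = j then E else if k ∈ S then C else ∅)) ⊆
        Finset.univ.filter (fun k => k = j ∧ C' ⊆ E) := by
      intro k hk
      simp only [Finset.mem_filter, Finset.mem_univ, true_and] at hk ⊢
      split_ifs at hk with h1 h2
      · exact ⟨h1, hk⟩
      · exact absurd hk hCC
      · exact absurd (Finset.subset_empty.1 hk) hC'
    have hle2 := Finset.card_le_card hsub2
    by_cases hE : C' ⊆ E
    · simp [hE, Finset.filter_eq'] at hle2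
      have : C'.card = Fintype.card (Fin Δ) := by simp; omega
      rw [Finset.card_eq_iff_eq_univ] at this
      subst this
      exact (Finset.subset_univ C).trans hE
    · simp [hE] at hle2
      simp [hle2] at hcard
      omega

lemma SigRR_eq {Δ r : ℕ} (hΔ : 2 ≤ Δ) (hr : 2 ≤ r) (Q) :
    Q ∈ SigRR Δ r ↔ ∃ C : Finset (Fin Δ), Q = gen2 Δ r C := by
  constructor
  · rintro ⟨m, hm, hQ⟩
    obtain ⟨q, rfl⟩ := exists_MM m hm.1.1
    obtain ⟨C, hC, hcard⟩ := hall_step hr q hm.1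
    have := hm.2 _ (NCand_std hr C hC _ hcard) (by
      apply rel_MM_mk
      intro j
      split_ifs with hj
      · simpa using hj
      · rw [gen2_empty hr]
        exact (((NCand_MM hr q).1 hm.1).1 j).2)
    rw [this] at hQ
    obtain ⟨j, rfl⟩ := (mem_MM _ _).1 hQ
    exact ⟨_, rfl⟩
  · rintro ⟨C, rfl⟩
    by_cases hC : C = ∅
    · subst hC
      let a : Fin Δ := ⟨0, by omega⟩
      let b : Fin Δ := ⟨1, by omega⟩
      have hab : b ≠ a := by simp [a, b]
      refine ⟨_, NRR_std hr Finset.univ (Finset.nonempty_iff_ne_empty.1 ⟨a, by simp⟩) {a}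
        (by simp [Nat.add_comm]), (mem_MM _ _).2 ⟨b, by simp [hab]⟩⟩
    · have h3 : C.card ≤ Δ := by simpa using Finset.card_le_univ C
      have h4 : 0 < C.card := Finset.card_pos.2 (Finset.nonempty_iff_ne_empty.2 hC)
      obtain ⟨S, hS, hcard⟩ := Finset.exists_subset_card_eq
        (s := (Finset.univ : Finset (Fin Δ))) (n := Δ - C.card + 1)
        (by rw [Finset.card_univ, Fintype.card_fin]; omega)
      obtain ⟨j, hj⟩ : S.Nonempty := Finset.card_pos.1 (by omega)
      exact ⟨_, NRR_std hr C hC S (by omega), (mem_MM _ _).2 ⟨j, by simp [hj]⟩⟩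

lemma map_MM {ι α β : Type*} [Fintype ι] (f : ι → α) (g : α → β) :
    (MM f).map g = MM (fun i => g (f i)) := by
  simp [MM]

/-- The label set Σ_ℛℛ of ℛ̄(ℛ(Π)) equals `{⟨⟨ℓ(C)⟩⟩ : C ⊆ 𝔠}`, and the hyperedge constraint
ℰ_ℛℛ consists exactly of the configurations `⟨⟨ℓ(C₁)⟩⟩ … ⟨⟨ℓ(C_r)⟩⟩` of such labels for
which, for each color `i ∈ 𝔠`, there is at least one index `j` with `i ∉ C_j`. -/
theorem stmt_6 (Δ r : ℕ) (hΔ : 2 ≤ Δ) (hr : 2 ≤ r) :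
    SigRR Δ r = {Q | ∃ C : Finset (Fin Δ), Q = gen2 Δ r C} ∧
    ERR Δ r = {m | ∃ Cs : Multiset (Finset (Fin Δ)), Multiset.card Cs = r ∧
        m = Cs.map (gen2 Δ r) ∧ ∀ i : Fin Δ, ∃ C ∈ Cs, i ∉ C} := by
  refine ⟨Set.ext fun Q => SigRR_eq hΔ hr Q, Set.ext fun m => ⟨?_, ?_⟩⟩
  · rintro ⟨hcard, hQ, c, hc, hER⟩
    obtain ⟨q, rfl⟩ := exists_MM m hcard
    have : ∀ j, ∃ C, q j = gen2 Δ r C :=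
      fun j => (SigRR_eq hΔ hr _).1 (hQ _ ((mem_MM _ _).2 ⟨j, rfl⟩))
    choose C hC using this
    obtain rfl : q = fun j => gen2 Δ r (C j) := funext hC
    obtain ⟨g, rfl, hg⟩ := rel_MM _ _ _ hc
    refine ⟨MM C, card_MM C, (map_MM _ _).symm, fun i => ?_⟩
    obtain ⟨j, hj⟩ := ((ECand_MM g).1 hER.1).2 i
    refine ⟨C j, (mem_MM _ _).2 ⟨j, rfl⟩, fun hi => ?_⟩
    obtain ⟨D, hCD, hD⟩ := hg j
    exact hj D (by rw [hD, mem_genE hr]) (hCD hi)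
  · rintro ⟨Cs, hcard, rfl, hCs⟩
    obtain ⟨C, rfl⟩ := exists_MM Cs hcard
    have : ∀ i, ∃ j, i ∉ C j := by
      intro i
      obtain ⟨D, hD, hi⟩ := hCs i
      obtain ⟨j, rfl⟩ := (mem_MM _ _).1 hD
      exact ⟨j, hi⟩
    choose u hu using this
    rw [map_MM]
    refine ⟨card_MM _, ?_, _, ?_, ER_of hr
      (fun j => Finset.univ.filter (fun i => j ≠ u i)) u (by intro i j; simp)⟩
    · intro Q hQ
      obtain ⟨j, rfl⟩ := (mem_MM _ _).1 hQ
      exact (SigRR_eq hΔ hr _).2 ⟨_, rfl⟩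
    · apply rel_MM_mk
      intro j
      rw [mem_gen2 hr]
      intro i hi
      simp only [Finset.mem_filter, Finset.mem_univ, true_and]
      rintro rfl
      exact hu i hi
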